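/- arXiv:2202.03607 — 2 statements merged into one kernel-verified Lean document; each statement's English description precedes it below -/
import Mathlib

section
/- Let A = M_m(ℂ), B = M_n(ℂ), C = M_p(ℂ) be matrix algebras and let Z = M_q(ℂ). Form the algebraic tensor products over ℂ with their canonical algebra structures. For a ℂ-linear map F : B → A define the bloom ⸤F : A ⊗ B → A as μ_A ∘ (id_A ⊗ F) and the swapped bloom ⸣F : A ⊗ B → A as μ_A ∘ (F ⊗ id_A) ∘ γ, where μ_A is the (linearized) multiplication of A and γ : A ⊗ B → B ⊗ A is the swap. For linear maps F : B → A and ω : A → Z define F⋆ω := (1/2)(ω∘⸤F + ω∘⸣F) : A ⊗ B → Z; analogously for G : C → B define G⋆F := (1/2)(F∘⸤G + F∘⸣G) : B ⊗ C → A. Let !_A ⊗ G : C → A ⊗ B be the linear map c ↦ 1_A ⊗ G(c), and let α : (A ⊗ B) ⊗ C ≃ A ⊗ (B ⊗ C) be the associator. Then for all linear maps G : C → B, F : B → A, ω : A → Z, the compositionality/associativity identity holds: (!_A ⊗ G) ⋆ (F ⋆ ω) = ((G ⋆ F) ⋆ ω) ∘ α as linear maps (A ⊗ B) ⊗ C →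 Z. -/
open scoped TensorProduct

noncomputable section

/-- The bloom `⸤F = μ_A ∘ (id_A ⊗ F) : A ⊗ B → A` of a linear map `F : B → A`. -/
def bloom {A B : Type*} [Ring A] [Ring B] [Algebra ℂ A] [Algebra ℂ B]
    (F : B →ₗ[ℂ] A) : A ⊗[ℂ] B →ₗ[ℂ] A :=
  LinearMap.mul' ℂ A ∘ₗ TensorProduct.map LinearMap.id F

/-- The swapped bloom `⸣F = μ_A ∘ (F ⊗ id_A) ∘ γ : A ⊗ B → A` of a linear map
`F : B → A`, where `γ : A ⊗ B → B ⊗ A` is the swap. -/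
def sbloom {A B : Type*} [Ring A] [Ring B] [Algebra ℂ A] [Algebra ℂ B]
    (F : B →ₗ[ℂ] A) : A ⊗[ℂ] B →ₗ[ℂ] A :=
  LinearMap.mul' ℂ A ∘ₗ TensorProduct.map F LinearMap.id ∘ₗ
    (TensorProduct.comm ℂ A B).toLinearMap

/-- The state-over-time assignment `F⋆ω := (1/2)(ω∘⸤F + ω∘⸣F)`. -/
def SoT {A B Z : Type*} [Ring A] [Ring B] [Algebra ℂ A] [Algebra ℂ B]
    [AddCommMonoid Z] [Module ℂ Z]
    (F : B →ₗ[ℂ] A) (ω : A →ₗ[ℂ] Z) : A ⊗[ℂ] B →ₗ[ℂ] Z :=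
  (1 / 2 : ℂ) • (ω ∘ₗ bloom F + ω ∘ₗ sbloom F)

/-- `!_A ⊗ G : C → A ⊗ B`, `c ↦ 1_A ⊗ G(c)`. -/
def bangTensor (A : Type*) {B C : Type*} [Ring A] [Ring B] [Algebra ℂ A]
    [Algebra ℂ B] [AddCommMonoid C] [Module ℂ C]
    (G : C →ₗ[ℂ] B) : C →ₗ[ℂ] A ⊗[ℂ] B :=
  TensorProduct.mk ℂ A B 1 ∘ₗ G

theorem bloom_tmul {A B : Type*} [Ring A] [Ring B] [Algebra ℂ A] [Algebra ℂ B]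
    (F : B →ₗ[ℂ] A) (a : A) (b : B) : bloom F (a ⊗ₜ[ℂ] b) = a * F b := by
  simp [bloom]

theorem sbloom_tmul {A B : Type*} [Ring A] [Ring B] [Algebra ℂ A] [Algebra ℂ B]
    (F : B →ₗ[ℂ] A) (a : A) (b : B) : sbloom F (a ⊗ₜ[ℂ] b) = F b * a := by
  simp [sbloom]

/-- On pure tensors, `F⋆ω` is `ω` applied to the Jordan product of `a` and `F b`. -/
theorem SoT_tmul {A B Z : Type*} [Ring A] [Ring B] [Algebra ℂ A] [Algebra ℂ B]
    [AddCommMonoid Z] [Module ℂ Z] (F : B →ₗ[ℂ] A) (ω : A →ₗ[ℂ] Z) (a : A) (b : B) :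
    SoT F ω (a ⊗ₜ[ℂ] b) = (1 / 2 : ℂ) • ω (a * F b + F b * a) := by
  simp [SoT, bloom_tmul, sbloom_tmul]

theorem bangTensor_apply (A : Type*) {B C : Type*} [Ring A] [Ring B] [Algebra ℂ A]
    [Algebra ℂ B] [AddCommMonoid C] [Module ℂ C] (G : C →ₗ[ℂ] B) (c : C) :
    bangTensor A G c = (1 : A) ⊗ₜ[ℂ] G c :=
  rfl

/-- Compositionality/associativity of the state over time:
`(!_A ⊗ G) ⋆ (F ⋆ ω) = ((G ⋆ F) ⋆ ω) ∘ α` for matrix algebras. -/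
theorem SoT_assoc {m n p q : ℕ}
    (G : Matrix (Fin p) (Fin p) ℂ →ₗ[ℂ] Matrix (Fin n) (Fin n) ℂ)
    (F : Matrix (Fin n) (Fin n) ℂ →ₗ[ℂ] Matrix (Fin m) (Fin m) ℂ)
    (ω : Matrix (Fin m) (Fin m) ℂ →ₗ[ℂ] Matrix (Fin q) (Fin q) ℂ) :
    SoT (bangTensor (Matrix (Fin m) (Fin m) ℂ) G) (SoT F ω)
      = SoT (SoT G F) ω ∘ₗ
        (TensorProduct.assoc ℂ (Matrix (Fin m) (Fin m) ℂ)
          (Matrix (Fin n) (Fin n) ℂ) (Matrix (Fin p) (Fin p) ℂ)).toLinearMap := by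
  refine TensorProduct.ext_threefold fun a b c => ?_
  simp only [LinearMap.comp_apply, LinearEquiv.coe_coe, TensorProduct.assoc_tmul, SoT_tmul,
    bangTensor_apply, Algebra.TensorProduct.tmul_mul_tmul, mul_one, one_mul,
    ← TensorProduct.tmul_add, mul_smul_comm, smul_mul_assoc, ← smul_add, map_smul]

end
end

section
/- Let S be a commutative star-subalgebra of M_m(ℂ) (a ℂ-subalgebra closed under conjugate transpose in which any two elements commute). Let E : M_m(ℂ) → M_m(ℂ) be a positive unital linear map with E(X) ∈ S for all X and E(s) = s for all s ∈ S (a conditional expectation onto S). Let ω : M_m(ℂ) → M_p(ℂ) be a linear map with ω ∘ E = ω, and let F : M_n(ℂ) → M_m(ℂ) be a linear map with F(B) ∈ S for all B ∈ M_n(ℂ). Then ω(A · F(B)) = ω(F(B) · A) for all A ∈ M_m(ℂ) and B ∈ M_n(ℂ); that is, for an effectively classical pair (F, ω) the bloom and swapped bloom compositions coincide, ω∘⸤F = ω∘⸣F (the preservation-of-classical-limit axiom for the state over time). -/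
open Matrix
open scoped ComplexOrder

/-- The two degenerate cases of the Cauchy-Schwarz inequality for a positive functional. -/
theorem positive_functional_mul_eq_zero {ι : Type*} [Fintype ι]
    (φ : Matrix ι ι ℂ →ₗ[ℂ] ℂ) (hφ : ∀ X : Matrix ι ι ℂ, X.PosSemidef → 0 ≤ φ X)
    {Y : Matrix ι ι ℂ} (hY : φ (Yᴴ * Y) = 0) (X : Matrix ι ι ℂ) :
    φ (X * Y) = 0 ∧ φ (Yᴴ * Xᴴ) = 0 := by
  have expand : ∀ c : ℂ, 0 ≤ φ (X * Xᴴ) + (c * φ (X * Y) + star c * φ (Yᴴ * Xᴴ)) := by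
    intro c
    have h := hφ _ (posSemidef_conjTranspose_mul_self (Xᴴ + c • Y))
    rw [add_comm (c * _)]
    simpa [add_mul, mul_add, hY, add_assoc] using h
  have cross : ∀ c : ℂ, c * φ (X * Y) + star c * φ (Yᴴ * Xᴴ) = 0 := by
    intro c
    have key : ∀ t : ℝ, 0 ≤ φ (X * Xᴴ) +
        t * (c * φ (X * Y) + star c * φ (Yᴴ * Xᴴ)) := by
      intro t
      have h := expand (t * c)
      simp only [star_mul', RCLike.star_def, Complex.conj_ofReal] at h ⊢
      convert h using 2
      ring
    generalize c * φ (X * Y) + star c * φ (Yᴴ * Xᴴ) = p at key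
    generalize φ (X * Xᴴ) = a at key
    simp only [Complex.le_def, Complex.zero_re, Complex.zero_im, Complex.add_re, Complex.add_im,
      Complex.re_ofReal_mul, Complex.im_ofReal_mul] at key
    apply Complex.ext
    · by_contra hp
      simp only [Complex.zero_re] at hp
      have h := (key (-(a.re + 1) / p.re)).1
      rw [div_mul_cancel₀ _ hp] at h
      linarith
    · have h₀ := (key 0).2
      have h₁ := (key 1).2
      simp only [Complex.zero_im]
      linarith
  have h₁ := cross 1
  have h₂ := cross Complex.I
  simp only [star_one, one_mul, RCLike.star_def, Complex.conj_I] at h₁ h₂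
  have h₃ : φ (X * Y) - φ (Yᴴ * Xᴴ) = 0 := by
    apply (mul_eq_zero.mp (_ : Complex.I * _ = 0)).resolve_left Complex.I_ne_zero
    linear_combination h₂
  exact ⟨by linear_combination (h₁ + h₃) / 2, by linear_combination (h₁ - h₃) / 2⟩

/-- A matrix commuting with a Hermitian matrix `s` vanishes as soon as its quadratic form vanishes
on the eigenvectors of `s`. -/
theorem eq_zero_of_inner_eigenvector_eq_zero {ι : Type*} [Fintype ι] [DecidableEq ι]
    {s T : Matrix ι ι ℂ} (hs : s.IsHermitian) (hT : Commute s T)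
    (h : ∀ (μ : ℂ) (v : EuclideanSpace ℂ ι), toEuclideanLin s v = μ • v →
      inner ℂ (toEuclideanLin T v) v = 0) : T = 0 := by
  have hsym := isSymmetric_toEuclideanLin_iff.mpr hs
  have htop := Submodule.orthogonal_eq_bot_iff.mp hsym.orthogonalComplement_iSup_eigenspaces_eq_bot
  have hcomm : ∀ v, toEuclideanLin s (toEuclideanLin T v) =
      toEuclideanLin T (toEuclideanLin s v) := by
    intro v
    have := congrArg (fun M => toEuclideanLin M v) hT.eq
    simpa [toLpLin_mul_same] using this
  suffices hker : LinearMap.ker (toEuclideanLin T) = ⊤ by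
    exact toEuclideanLin.map_eq_zero_iff.mp (LinearMap.ker_eq_top.mp hker)
  rw [eq_top_iff, ← htop, iSup_le_iff]
  intro μ v hv
  have hmaps : ∀ w ∈ Module.End.eigenspace (toEuclideanLin s) μ,
      toEuclideanLin T w ∈ Module.End.eigenspace (toEuclideanLin s) μ := by
    intro w hw
    rw [Module.End.mem_eigenspace_iff] at hw ⊢
    rw [hcomm, hw, map_smul]
  have hres : (toEuclideanLin T).restrict hmaps = 0 := by
    refine (inner_map_self_eq_zero (V := Module.End.eigenspace (toEuclideanLin s) μ)
      ((toEuclideanLin T).restrict hmaps)).mp ?_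
    intro w
    exact h μ w (Module.End.mem_eigenspace_iff.mp w.2)
  exact congrArg Subtype.val (LinearMap.congr_fun hres ⟨v, hv⟩)

/-- A positive map onto a commutative star-subalgebra `S` fixing `S` pointwise is tracial
against the Hermitian elements of `S`. -/
theorem map_mul_comm_of_isHermitian {ι : Type*} [Fintype ι] [DecidableEq ι]
    (S : Subalgebra ℂ (Matrix ι ι ℂ))
    (hScomm : ∀ x ∈ S, ∀ y ∈ S, x * y = y * x)
    (E : Matrix ι ι ℂ →ₗ[ℂ] Matrix ι ι ℂ)
    (hEpos : ∀ X : Matrix ι ι ℂ, X.PosSemidef → (E X).PosSemidef)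
    (hErange : ∀ X : Matrix ι ι ℂ, E X ∈ S)
    (hEfix : ∀ s ∈ S, E s = s)
    {s : Matrix ι ι ℂ} (hs : s ∈ S) (hherm : s.IsHermitian) (X : Matrix ι ι ℂ) :
    E (X * s) = E (s * X) := by
  rw [← sub_eq_zero]
  refine eq_zero_of_inner_eigenvector_eq_zero hherm
    (hScomm _ hs _ (sub_mem (hErange _) (hErange _))) ?_
  intro μ v hv
  let φ : Matrix ι ι ℂ →ₗ[ℂ] ℂ :=
    (innerₛₗ ℂ v) ∘ₗ LinearMap.applyₗ v ∘ₗ toEuclideanLin.toLinearMap ∘ₗ E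
  have hφ_apply : ∀ Y, φ Y = inner ℂ v (toEuclideanLin (E Y) v) := fun _ => rfl
  have hφ : ∀ Y : Matrix ι ι ℂ, Y.PosSemidef → 0 ≤ φ Y := fun Y hY =>
    (isPositive_toEuclideanLin_iff.mpr (hEpos Y hY)).inner_nonneg_right v
  let Y : Matrix ι ι ℂ := s - μ • 1
  have hYstar : Yᴴ = s - star μ • 1 := by simp [Y, hherm.eq]
  have hYS : Y ∈ S := sub_mem hs (S.smul_mem S.one_mem μ)
  have hYstarS : Yᴴ ∈ S := hYstar ▸ sub_mem hs (S.smul_mem S.one_mem (star μ))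
  have hYv : toEuclideanLin Y v = 0 := by simp [Y, hv, toLpLin_one]
  have hY₁ : φ (Yᴴ * Y) = 0 := by
    rw [hφ_apply, hEfix _ (S.mul_mem hYstarS hYS), toLpLin_mul_same, LinearMap.comp_apply, hYv]
    simp
  have hY₂ : φ (Yᴴᴴ * Yᴴ) = 0 := by
    rwa [conjTranspose_conjTranspose, hScomm _ hYS _ hYstarS]
  have hr := (positive_functional_mul_eq_zero φ hφ hY₁ X).1
  have hl := (positive_functional_mul_eq_zero φ hφ hY₂ Xᴴ).2
  rw [conjTranspose_conjTranspose, conjTranspose_conjTranspose] at hl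
  simp only [Y, mul_sub, sub_mul, mul_smul_comm, smul_mul_assoc, mul_one, one_mul, map_sub] at hl hr
  rw [← inner_conj_symm, ← map_sub, ← hφ_apply, map_sub, sub_eq_zero.mp hl, sub_eq_zero.mp hr]
  simp

/-- Preservation of the classical limit: if `(F, ω)` is effectively classical
(factors through a commutative star-subalgebra via a state-preserving
conditional expectation), then `ω(A·F(B)) = ω(F(B)·A)` for all `A`, `B`,
i.e. `ω∘⸤F = ω∘⸣F`. -/
theorem classical_limit_bloom_eq_swappedBloom {m n p : ℕ}
    (S : Subalgebra ℂ (Matrix (Fin m) (Fin m) ℂ))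
    (hScomm : ∀ x ∈ S, ∀ y ∈ S, x * y = y * x)
    (hSstar : ∀ x ∈ S, xᴴ ∈ S)
    (E : Matrix (Fin m) (Fin m) ℂ →ₗ[ℂ] Matrix (Fin m) (Fin m) ℂ)
    (hEpos : ∀ X : Matrix (Fin m) (Fin m) ℂ, X.PosSemidef → (E X).PosSemidef)
    (hEunital : E 1 = 1)
    (hErange : ∀ X : Matrix (Fin m) (Fin m) ℂ, E X ∈ S)
    (hEfix : ∀ s ∈ S, E s = s)
    (ω : Matrix (Fin m) (Fin m) ℂ →ₗ[ℂ] Matrix (Fin p) (Fin p) ℂ)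
    (hωE : ω ∘ₗ E = ω)
    (F : Matrix (Fin n) (Fin n) ℂ →ₗ[ℂ] Matrix (Fin m) (Fin m) ℂ)
    (hFS : ∀ B : Matrix (Fin n) (Fin n) ℂ, F B ∈ S) :
    ∀ (A : Matrix (Fin m) (Fin m) ℂ) (B : Matrix (Fin n) (Fin n) ℂ),
      ω (A * F B) = ω (F B * A) := by
  intro A B
  have hωE' : ∀ X, ω (E X) = ω X := LinearMap.congr_fun hωE
  rw [← hωE' (A * F B), ← hωE' (F B * A)]
  congr 1
  have hs := hFS B
  generalize F B = s at hs ⊢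
  have hstar := hSstar s hs
  have h₁ := map_mul_comm_of_isHermitian S hScomm E hEpos hErange hEfix (S.add_mem hs hstar)
    (isHermitian_add_transpose_self s) A
  have h₂ := map_mul_comm_of_isHermitian S hScomm E hEpos hErange hEfix
    (S.smul_mem (S.sub_mem hs hstar) Complex.I)
    (by simp [IsHermitian, ← smul_neg]) A
  simp only [mul_add, add_mul, mul_sub, sub_mul, mul_smul_comm, smul_mul_assoc, map_add, map_sub,
    map_smul] at h₁ h₂
  have h₃ := smul_right_injective _ Complex.I_ne_zero h₂
  have h₄ : (2 : ℂ) • E (A * s) = (2 : ℂ) • E (s * A) := by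
    calc (2 : ℂ) • E (A * s)
        = (E (A * s) + E (A * sᴴ)) + (E (A * s) - E (A * sᴴ)) := by module
      _ = (E (s * A) + E (sᴴ * A)) + (E (s * A) - E (sᴴ * A)) := by
        exact congrArg₂ (· + ·) h₁ h₃
      _ = (2 : ℂ) • E (s * A) := by module
  exact smul_right_injective _ two_ne_zero h₄
end
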